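/- For every fixed integer k ≥ 1, the probability under the distribution D that the image of the drawn string misses exactly k elements satisfies lim_{m→∞} Pr_{Z∼D}[ |Im(Z)| = M − k ] = 1/(e·(k−1)!). -/

import Mathlib

namespace GLN

noncomputable section

open Finset

/-- `M = 2^m`. -/
def MM (m : ℕ) : ℕ := 2 ^ m

/-- `N = ⌈M · m · ln 2⌉`. -/
def NN (m : ℕ) : ℕ := ⌈(MM m : ℝ) * m * Real.log 2⌉₊

/-- Strings `X ∈ [M]^N`. -/
abbrev Str (m : ℕ) := Fin (NN m) → Fin (MM m)

/-- The uniform probability mass function on `[M]^N`. -/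
def umass (m : ℕ) (_X : Str m) : ℝ := 1 / (MM m : ℝ) ^ NN m

/-- The image `Im(X) ⊆ [M]` of a string, as a finset. -/
def img {m : ℕ} (X : Str m) : Finset (Fin (MM m)) := Finset.image X Finset.univ

/-- Transition kernel of `D_y(X)`: each coordinate with `x_i = y` is replaced by a uniform
independent sample from `[M] \ {y}`; other coordinates are unchanged. -/
def kerDy (m : ℕ) (y : Fin (MM m)) (X Z : Str m) : ℝ :=
  ∏ i, if X i = y then (if Z i = y then 0 else 1 / ((MM m : ℝ) - 1))
       else (if Z i = X i then 1 else 0)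

/-- Transition kernel of `D(X)`: choose `y` uniformly in `[M]`, then apply `D_y`. -/
def kerD (m : ℕ) (X Z : Str m) : ℝ := (1 / (MM m : ℝ)) * ∑ y, kerDy m y X Z

/-- The probability mass function of the distribution `D = D(U)`. -/
def dmass (m : ℕ) (Z : Str m) : ℝ := ∑ X, umass m X * kerD m X Z

/-- Transition kernel of `D_y^inv(Z)`: each coordinate is independently replaced by `y`
with probability `1/M` and left unchanged otherwise. -/
def kerDinvy (m : ℕ) (y : Fin (MM m)) (Z W : Str m) : ℝ :=
  ∏ i, ((1 / (MM m : ℝ)) * (if W i = y then 1 else 0)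
        + (1 - 1 / (MM m : ℝ)) * (if W i = Z i then 1 else 0))

/-- Transition kernel of `D^inv(Z)`: choose `y` uniformly in `[M] \ Im(Z)`,
then apply `D_y^inv`. -/
def kerDinv (m : ℕ) (Z W : Str m) : ℝ :=
  (1 / (((img Z)ᶜ.card : ℝ))) * ∑ y ∈ (img Z)ᶜ, kerDinvy m y Z W

/-- Probability of an event under a mass function. -/
def pr {m : ℕ} (μ : Str m → ℝ) (E : Set (Str m)) : ℝ := ∑ X, E.indicator μ X

/-- Expectation of a real function under a mass function. -/
def ev {m : ℕ} (μ : Str m → ℝ) (g : Str m → ℝ) : ℝ := ∑ X, μ X * g X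

/-- The surjectivity function `f_Surj`. -/
def fSurjB (m : ℕ) (X : Str m) : Bool := decide (img X = Finset.univ)

/-- The `q.2`-th bit of the binary encoding of coordinate `x_{q.1}` of `X`;
this realizes `X` as a string of `n = N·m` bits. -/
def bit {m : ℕ} (X : Str m) (q : Fin (NN m) × Fin m) : Bool :=
  Nat.testBit (X q.1).val q.2.val

lemma ker_sum {M : ℕ} (hM : 2 ≤ M) (y z : Fin M) :
    (∑ x : Fin M, (if x = y then (if z = y then (0:ℝ) else 1 / ((M : ℝ) - 1))
       else (if z = x then 1 else 0))) = if z = y then 0 else (M : ℝ) / ((M : ℝ) - 1) := by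
  have hM' : (M : ℝ) - 1 ≠ 0 := by
    have : (2 : ℝ) ≤ M := by exact_mod_cast hM
    linarith
  by_cases h : z = y
  · subst h
    simp only [if_true]
    apply Finset.sum_eq_zero
    intro x _
    by_cases hx : x = z
    · simp [hx]
    · simp [hx, Ne.symm hx]
  · simp only [h, if_false]
    have : ∀ x : Fin M, (if x = y then 1 / ((M : ℝ) - 1) else (if z = x then 1 else 0))
        = (if x = y then 1 / ((M : ℝ) - 1) else 0) + (if z = x then 1 else 0) := by
      intro x
      by_cases hx : x = y
      · subst hx; simp [h]
      · simp [hx]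
    simp only [this, Finset.sum_add_distrib, Finset.sum_ite_eq, Finset.sum_ite_eq',
      Finset.mem_univ, if_true]
    field_simp
    ring

lemma kerDy_sum (m : ℕ) (hM : 2 ≤ MM m) (y : Fin (MM m)) (Z : Str m) :
    ∑ X, umass m X * kerDy m y X Z
      = if y ∈ (img Z)ᶜ then (1 / ((MM m : ℝ) - 1)) ^ NN m else 0 := by
  have hM0 : (MM m : ℝ) ≠ 0 := by
    have : MM m ≠ 0 := by omega
    exact_mod_cast this
  have h1 : ∑ X, kerDy m y X Z = ∏ i, (if Z i = y then 0 else (MM m : ℝ) / ((MM m : ℝ) - 1)) := by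
    simp only [← ker_sum hM y]
    rw [Finset.prod_univ_sum, Fintype.piFinset_univ]
    rfl
  simp only [umass]
  rw [← Finset.mul_sum, h1]
  by_cases hy : y ∈ (img Z)ᶜ
  · rw [if_pos hy]
    have : ∀ i, Z i ≠ y := by
      intro i hi
      simp only [img, Finset.mem_compl, Finset.mem_image, Finset.mem_univ, true_and] at hy
      exact hy ⟨i, hi⟩
    simp only [this, if_false, Finset.prod_const, Finset.card_univ, Fintype.card_fin]
    rw [div_pow, div_pow, one_pow]
    field_simp
  · rw [if_neg hy]
    simp only [img, Finset.mem_compl, Finset.mem_image, Finset.mem_univ, true_and, not_not] at hy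
    obtain ⟨i, hi⟩ := hy
    rw [Finset.prod_eq_zero (Finset.mem_univ i) (by simp [hi]), mul_zero]

lemma dmass_eq (m : ℕ) (hM : 2 ≤ MM m) (Z : Str m) :
    dmass m Z = (1 / (MM m : ℝ)) * ((img Z)ᶜ.card * (1 / ((MM m : ℝ) - 1)) ^ NN m) := by
  have : dmass m Z = (1 / (MM m : ℝ)) * ∑ y, ∑ X, umass m X * kerDy m y X Z := by
    unfold dmass kerD
    rw [Finset.sum_comm, Finset.mul_sum]
    apply Finset.sum_congr rfl
    intro X _
    rw [← Finset.mul_sum]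
    ring
  rw [this]
  simp only [kerDy_sum m hM]
  rw [← Finset.sum_filter, Finset.filter_mem_eq_inter, Finset.univ_inter, Finset.sum_const,
    nsmul_eq_mul]

lemma ind_choose (a k L : ℕ) (h : a ≤ L) :
    (if a = k then (1 : ℝ) else 0)
      = ∑ i ∈ range (L + 1), (-1 : ℝ) ^ i * ((k + i).choose k) * (a.choose (k + i)) := by
  have h1 : ∀ i, (-1 : ℝ) ^ i * ((k + i).choose k) * (a.choose (k + i))
      = (a.choose k) * ((-1 : ℝ) ^ i * ((a - k).choose i)) := by
    intro i
    have := Nat.choose_mul (n := a) (k := k + i) (s := k) (by omega)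
    rw [show k + i - k = i by omega] at this
    have h2 : (a.choose (k + i) : ℝ) * ((k + i).choose k) = a.choose k * (a - k).choose i := by
      exact_mod_cast this
    linear_combination (-1 : ℝ) ^ i * h2
  simp only [h1]
  rw [← Finset.mul_sum]
  have h3 : ∑ i ∈ range (L + 1), (-1 : ℝ) ^ i * ((a - k).choose i)
      = ∑ i ∈ range (a - k + 1), (-1 : ℝ) ^ i * ((a - k).choose i) := by
    symm
    apply Finset.sum_subset
    · intro x hx
      simp only [Finset.mem_range] at *
      omega
    · intro x _ hx
      simp only [Finset.mem_range] at hx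
      rw [Nat.choose_eq_zero_of_lt (by omega)]
      simp
  have h4 : ∑ i ∈ range (a - k + 1), (-1 : ℝ) ^ i * ((a - k).choose i)
      = if a - k = 0 then 1 else 0 := by
    have := Int.alternating_sum_range_choose (n := a - k)
    exact_mod_cast this
  rw [h3, h4]
  rcases lt_trichotomy a k with h | h | h
  · rw [if_neg (by omega), Nat.choose_eq_zero_of_lt h]; simp
  · subst h; simp
  · rw [if_neg (by omega), if_neg (by omega)]; simp

lemma sum_choose (m j : ℕ) :
    ∑ Z : Str m, (((img Z)ᶜ.card.choose j : ℕ) : ℝ)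
      = ((MM m).choose j : ℝ) * ((MM m - j : ℕ) : ℝ) ^ NN m := by
  have h1 : ∀ Z : Str m, (((img Z)ᶜ.card.choose j : ℕ) : ℝ)
      = ∑ T ∈ powersetCard j (univ : Finset (Fin (MM m))), if T ⊆ (img Z)ᶜ then (1 : ℝ) else 0 := by
    intro Z
    rw [← Finset.card_powersetCard, ← Finset.sum_filter, Finset.sum_const, nsmul_eq_mul, mul_one]
    congr 2
    ext T
    simp only [Finset.mem_powersetCard, Finset.mem_filter, Finset.subset_univ, true_and]
    tauto
  simp only [h1]
  rw [Finset.sum_comm]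
  have h2 : ∀ T ∈ powersetCard j (univ : Finset (Fin (MM m))),
      ∑ Z : Str m, (if T ⊆ (img Z)ᶜ then (1 : ℝ) else 0) = ((MM m - j : ℕ) : ℝ) ^ NN m := by
    intro T hT
    have hc : T.card = j := (Finset.mem_powersetCard.1 hT).2
    rw [← Finset.sum_filter, Finset.sum_const, nsmul_eq_mul, mul_one]
    have : (univ.filter fun Z : Str m => T ⊆ (img Z)ᶜ) = Fintype.piFinset (fun _ => Tᶜ) := by
      ext Z
      simp only [Finset.mem_filter, Finset.mem_univ, true_and, Fintype.mem_piFinset,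
        Finset.mem_compl, Finset.subset_iff, img, Finset.mem_image, not_exists]
      constructor
      · intro h i hi
        exact h hi i rfl
      · intro h x hx i hi
        exact h i (hi ▸ hx)
    rw [this, Fintype.card_piFinset]
    simp [Finset.card_compl, hc]
  rw [Finset.sum_congr rfl h2, Finset.sum_const, Finset.card_powersetCard]
  simp

/-- the i-th inclusion-exclusion term -/
def tm (k m i : ℕ) : ℝ :=
  (-1 : ℝ) ^ i * ((k + i).choose k) * (k / (MM m : ℝ)) * ((MM m).choose (k + i) : ℝ)
    * (((MM m - (k + i) : ℕ) : ℝ) * (1 / ((MM m : ℝ) - 1))) ^ NN m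

lemma pr_eq (k m : ℕ) (hM : 2 ≤ MM m) (hk : k ≤ MM m) :
    pr (dmass m) {Z : Str m | (img Z).card = MM m - k} = ∑' i, tm k m i := by
  have h0 : ∑' i, tm k m i = ∑ i ∈ range (MM m + 1), tm k m i := by
    apply tsum_eq_sum
    intro i hi
    simp only [Finset.mem_range] at hi
    unfold tm
    rw [Nat.choose_eq_zero_of_lt (show MM m < k + i by omega)]
    simp
  have h1 : ∀ Z : Str m, Set.indicator {Z : Str m | (img Z).card = MM m - k} (dmass m) Z
      = (k / (MM m : ℝ)) * (1 / ((MM m : ℝ) - 1)) ^ NN m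
        * (if (img Z)ᶜ.card = k then 1 else 0) := by
    intro Z
    have hle : (img Z).card ≤ MM m := by simpa using Finset.card_le_univ (img Z)
    have hc : (img Z)ᶜ.card = MM m - (img Z).card := by simp [Finset.card_compl]
    by_cases h : (img Z).card = MM m - k
    · rw [Set.indicator_of_mem (by exact h), dmass_eq m hM, if_pos (by omega),
        show (img Z)ᶜ.card = k by omega]
      ring
    · rw [Set.indicator_of_notMem (by exact h), if_neg (by omega)]
      simp
  unfold pr
  simp only [h1]
  have h2 : ∀ Z : Str m, (if (img Z)ᶜ.card = k then (1 : ℝ) else 0)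
      = ∑ i ∈ range (MM m + 1), (-1 : ℝ) ^ i * ((k + i).choose k)
        * ((img Z)ᶜ.card.choose (k + i)) := fun Z =>
    ind_choose _ _ _ (by simpa using Finset.card_le_univ (img Z)ᶜ)
  simp only [h2]
  rw [← Finset.mul_sum, Finset.sum_comm, h0, Finset.mul_sum]
  apply Finset.sum_congr rfl
  intro i _
  rw [← Finset.mul_sum, sum_choose, tm, mul_pow]
  ring

lemma NN_lower (m : ℕ) : (MM m : ℝ) * Real.log (MM m) ≤ NN m := by
  have : Real.log (MM m) = m * Real.log 2 := by simp [MM]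
  rw [this, ← mul_assoc]
  exact Nat.le_ceil _

lemma NN_upper (m : ℕ) : (NN m : ℝ) ≤ (MM m : ℝ) * Real.log (MM m) + 1 := by
  have : Real.log (MM m) = m * Real.log 2 := by simp [MM]
  rw [this, ← mul_assoc]
  exact (Nat.ceil_lt_add_one (by have := Real.log_nonneg (x := 2) (by norm_num); positivity)).le

lemma q_upper (m j : ℕ) (hM : 2 ≤ MM m) (hj : j + 1 ≤ MM m) :
    (MM m : ℝ) ^ j * (((MM m - (j + 1) : ℕ) : ℝ) * (1 / ((MM m : ℝ) - 1))) ^ NN m ≤ 1 := by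
  have hN := NN_lower m
  set M : ℝ := (MM m : ℝ) with hMdef
  have hM2 : (2 : ℝ) ≤ M := by rw [hMdef]; exact_mod_cast hM
  have hL : 0 ≤ Real.log M := Real.log_nonneg (by linarith)
  have hcast : ((MM m - (j + 1) : ℕ) : ℝ) = M - (j + 1) := by push_cast [Nat.cast_sub hj]; rfl
  have hjr : (j : ℝ) + 1 ≤ M := by rw [hMdef]; exact_mod_cast hj
  have hq : (M - (j + 1)) * (1 / (M - 1)) ≤ Real.exp (-(j / M)) := by
    have h1 := Real.add_one_le_exp (-((j : ℝ) / M))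
    refine le_trans ?_ h1
    rw [mul_one_div, div_le_iff₀ (by linarith)]
    have : (j : ℝ) / M * M = j := by field_simp
    have h0 : 0 ≤ (j : ℝ) / M := by positivity
    nlinarith
  have hq0 : 0 ≤ (M - (j + 1)) * (1 / (M - 1)) :=
    mul_nonneg (by linarith) (one_div_nonneg.2 (by linarith))
  have hMe : M ^ j = Real.exp (j * Real.log M) := by
    rw [Real.exp_nat_mul, Real.exp_log (by linarith)]
  rw [hcast, hMe]
  calc _ ≤ Real.exp (j * Real.log M) * (Real.exp (-(j / M))) ^ NN m := by gcongr
    _ = Real.exp (j * Real.log M + NN m * (-(j / M))) := by rw [← Real.exp_nat_mul, Real.exp_add]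
    _ ≤ 1 := by
      rw [Real.exp_le_one_iff]
      have : (j : ℝ) / M * (M * Real.log M) = j * Real.log M := by field_simp
      have h0 : 0 ≤ (j : ℝ) / M := by positivity
      nlinarith [mul_le_mul_of_nonneg_left hN h0]

lemma q_lower (m j : ℕ) (hM : 2 ≤ MM m) (hj : j + 1 < MM m) :
    Real.exp (-((j : ℝ) * ((j + 1) * Real.log (MM m) + 1) / ((MM m : ℝ) - (j + 1)))) ≤
    (MM m : ℝ) ^ j * (((MM m - (j + 1) : ℕ) : ℝ) * (1 / ((MM m : ℝ) - 1))) ^ NN m := by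
  have hN := NN_upper m
  have hcast : ((MM m - (j + 1) : ℕ) : ℝ) = (MM m : ℝ) - (j + 1) := by
    push_cast [Nat.cast_sub hj.le]; rfl
  have hjr : (j : ℝ) + 1 < MM m := by exact_mod_cast hj
  have hM2 : (2 : ℝ) ≤ MM m := by exact_mod_cast hM
  rw [hcast]
  set M : ℝ := (MM m : ℝ) with hMdef
  have hpos : 0 < M - (j + 1) := by linarith
  have hq : Real.exp (-(j / (M - (j + 1)))) ≤ (M - (j + 1)) * (1 / (M - 1)) := by
    have h1 := Real.add_one_le_exp ((j : ℝ) / (M - (j + 1)))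
    have h2 : (j : ℝ) / (M - (j + 1)) + 1 = (M - 1) / (M - (j + 1)) := by
      field_simp; ring
    rw [h2] at h1
    rw [Real.exp_neg, mul_one_div, ← inv_div (M - 1)]
    apply inv_anti₀ _ h1
    exact div_pos (by linarith) hpos
  have hMe : M ^ j = Real.exp (j * Real.log M) := by
    rw [Real.exp_nat_mul, Real.exp_log (by linarith)]
  rw [hMe]
  calc _ ≤ Real.exp (j * Real.log M + NN m * (-(j / (M - (j + 1))))) := by
        apply Real.exp_le_exp.2
        have h0 : 0 ≤ (j : ℝ) / (M - (j + 1)) := by positivity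
        have h3 := mul_le_mul_of_nonneg_left hN h0
        have h4 : -((j : ℝ) * ((j + 1) * Real.log M + 1) / (M - (j + 1)))
            = j * Real.log M - (j : ℝ) / (M - (j + 1)) * (M * Real.log M + 1) := by
          field_simp; ring
        rw [h4]
        linarith
    _ = Real.exp (j * Real.log M) * (Real.exp (-(j / (M - (j + 1))))) ^ NN m := by
        rw [← Real.exp_nat_mul, Real.exp_add]
    _ ≤ _ := by gcongr

lemma MM_tendsto : Filter.Tendsto MM Filter.atTop Filter.atTop :=
  tendsto_pow_atTop_atTop_of_one_lt (by norm_num)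

lemma q_tendsto (j : ℕ) : Filter.Tendsto (fun m =>
    (MM m : ℝ) ^ j * (((MM m - (j + 1) : ℕ) : ℝ) * (1 / ((MM m : ℝ) - 1))) ^ NN m)
    Filter.atTop (nhds 1) := by
  have hr : Filter.Tendsto (fun x : ℝ =>
      -((j : ℝ) * ((j + 1) * Real.log x + 1) / (x - (j + 1)))) Filter.atTop (nhds 0) := by
    have hx : Filter.Tendsto (fun x : ℝ => x - ((j : ℝ) + 1)) Filter.atTop Filter.atTop :=
      Filter.tendsto_atTop_add_const_right _ _ Filter.tendsto_id
    have hl : (fun x : ℝ => (j : ℝ) * ((j + 1) * Real.log x + 1)) =o[Filter.atTop]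
        (fun x : ℝ => x) := by
      apply Asymptotics.IsLittleO.const_mul_left
      apply Asymptotics.IsLittleO.add
      · exact Real.isLittleO_log_id_atTop.const_mul_left _
      · exact Asymptotics.isLittleO_const_id_atTop _
    have hO : (fun x : ℝ => x) =O[Filter.atTop] (fun x : ℝ => x - ((j : ℝ) + 1)) := by
      apply Asymptotics.IsBigO.of_bound 2
      filter_upwards [Filter.eventually_ge_atTop (2 * ((j : ℝ) + 1))] with x hx
      have : 0 ≤ (j : ℝ) := by positivity
      rw [Real.norm_of_nonneg (by linarith), Real.norm_of_nonneg (by linarith)]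
      linarith
    simpa using ((hl.trans_isBigO hO).tendsto_div_nhds_zero).neg
  have hM : Filter.Tendsto (fun m => (MM m : ℝ)) Filter.atTop Filter.atTop :=
    tendsto_natCast_atTop_atTop.comp MM_tendsto
  have h1 := (Real.continuous_exp.tendsto 0).comp (hr.comp hM)
  rw [Real.exp_zero] at h1
  refine tendsto_of_tendsto_of_tendsto_of_le_of_le' h1 tendsto_const_nhds ?_ ?_
  · filter_upwards [MM_tendsto.eventually_ge_atTop (j + 2)] with m hm
    exact q_lower m j (by omega) (by omega)
  · filter_upwards [MM_tendsto.eventually_ge_atTop (j + 2)] with m hm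
    exact q_upper m j (by omega) (by omega)

lemma choose_div_tendsto (j : ℕ) : Filter.Tendsto (fun m =>
    ((MM m).choose j : ℝ) / (MM m : ℝ) ^ j) Filter.atTop (nhds (1 / (j.factorial : ℝ))) := by
  have h := (isEquivalent_choose j).comp_tendsto MM_tendsto
  have h2 : ∀ᶠ m in Filter.atTop, (MM m : ℝ) ^ j / (j.factorial : ℝ) ≠ 0 := by
    filter_upwards [MM_tendsto.eventually_ge_atTop 1] with m hm
    have : (0 : ℝ) < MM m := by exact_mod_cast hm
    positivity
  have h3 := (Asymptotics.isEquivalent_iff_tendsto_one (by simpa [Function.comp_def] using h2)).1 h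
  have h4 := h3.mul_const (1 / (j.factorial : ℝ))
  rw [one_mul] at h4
  refine h4.congr ?_
  intro m
  have : (j.factorial : ℝ) ≠ 0 := by positivity
  simp only [Pi.div_apply, Function.comp_apply]
  field_simp

lemma fact_id (k i : ℕ) : (((k + 1 + i).choose (k + 1) : ℕ) : ℝ) * ((k + 1 : ℕ) : ℝ)
    * (1 / ((k + 1 + i).factorial : ℝ)) = 1 / (k.factorial * i.factorial : ℝ) := by
  rw [Nat.cast_choose ℝ (show k + 1 ≤ k + 1 + i by omega), show k + 1 + i - (k + 1) = i by omega,
    Nat.factorial_succ k]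
  have h1 : (k.factorial : ℝ) ≠ 0 := by positivity
  have h2 : (i.factorial : ℝ) ≠ 0 := by positivity
  have h3 : ((k + 1 + i).factorial : ℝ) ≠ 0 := by positivity
  have h4 : ((k + 1 : ℕ) : ℝ) ≠ 0 := by positivity
  push_cast at *
  field_simp

lemma tm_eq (k m i : ℕ) (hM : 2 ≤ MM m) : tm (k + 1) m i =
    (-1 : ℝ) ^ i * (((k + 1 + i).choose (k + 1) : ℕ) : ℝ) * ((k + 1 : ℕ) : ℝ)
      * (((MM m).choose (k + i + 1) : ℝ) / (MM m : ℝ) ^ (k + i + 1))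
      * ((MM m : ℝ) ^ (k + i) *
        (((MM m - (k + i + 1) : ℕ) : ℝ) * (1 / ((MM m : ℝ) - 1))) ^ NN m) := by
  have : (MM m : ℝ) ≠ 0 := by
    have : MM m ≠ 0 := by omega
    exact_mod_cast this
  unfold tm
  rw [show k + 1 + i = k + i + 1 by omega]
  generalize (((MM m - (k + i + 1) : ℕ) : ℝ) * (1 / ((MM m : ℝ) - 1))) ^ NN m = Q
  rw [pow_succ (MM m : ℝ)]
  field_simp

lemma tm_tendsto (k i : ℕ) : Filter.Tendsto (fun m => tm (k + 1) m i) Filter.atTop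
    (nhds ((-1 : ℝ) ^ i * (1 / (k.factorial * i.factorial : ℝ)))) := by
  have h := ((choose_div_tendsto (k + i + 1)).const_mul
    ((-1 : ℝ) ^ i * (((k + 1 + i).choose (k + 1) : ℕ) : ℝ) * ((k + 1 : ℕ) : ℝ))).mul
    (q_tendsto (k + i))
  rw [← fact_id, show (k + 1 + i).factorial = (k + i + 1).factorial by congr 1; omega]
  convert h.congr' ?_ using 2
  · ring
  · filter_upwards [MM_tendsto.eventually_ge_atTop 2] with m hm
    rw [tm_eq k m i hm]

lemma tm_bound (k m i : ℕ) (hM : 2 ≤ MM m) :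
    ‖tm (k + 1) m i‖ ≤ 1 / (k.factorial * i.factorial : ℝ) := by
  by_cases hle : k + i + 1 ≤ MM m
  · have hM2 : (2 : ℝ) ≤ MM m := by exact_mod_cast hM
    have hq := q_upper m (k + i) hM hle
    have hq0 : 0 ≤ (MM m : ℝ) ^ (k + i) *
        (((MM m - (k + i + 1) : ℕ) : ℝ) * (1 / ((MM m : ℝ) - 1))) ^ NN m := by
      have : 0 ≤ 1 / ((MM m : ℝ) - 1) := one_div_nonneg.2 (by linarith)
      positivity
    rw [tm_eq k m i hM]
    have hc : ((MM m).choose (k + i + 1) : ℝ) / (MM m : ℝ) ^ (k + i + 1)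
        ≤ 1 / ((k + i + 1).factorial : ℝ) := by
      have := Nat.choose_le_pow_div (α := ℝ) (k + i + 1) (MM m)
      rw [div_le_iff₀ (by positivity)]
      calc _ ≤ _ := this
        _ = _ := by ring
    rw [norm_mul, norm_mul, norm_mul, norm_mul, norm_pow, norm_neg, norm_one, one_pow, one_mul,
      Real.norm_of_nonneg hq0, Real.norm_of_nonneg (by positivity),
      Real.norm_of_nonneg (by positivity), Real.norm_of_nonneg (by positivity), ← fact_id,
      show (k + 1 + i).factorial = (k + i + 1).factorial by congr 1; omega]
    calc _ ≤ (((k + 1 + i).choose (k + 1) : ℕ) : ℝ) * ((k + 1 : ℕ) : ℝ)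
            * (1 / ((k + i + 1).factorial : ℝ)) * 1 := by gcongr
      _ = _ := mul_one _
  · unfold tm
    rw [Nat.choose_eq_zero_of_lt (show MM m < k + 1 + i by omega)]
    simp
    positivity

/-- for every fixed `k ≥ 1`,
`Pr_{Z∼D}[|Im(Z)| = M − k] → 1/(e·(k−1)!)` as `m → ∞`. -/
theorem stmt9 (k : ℕ) (hk : 1 ≤ k) :
    Filter.Tendsto (fun m : ℕ => pr (dmass m) {Z : Str m | (img Z).card = MM m - k})
      Filter.atTop (nhds (1 / (Real.exp 1 * (Nat.factorial (k - 1) : ℝ)))) := by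
  obtain ⟨k, rfl⟩ : ∃ k', k = k' + 1 := ⟨k - 1, by omega⟩
  have hs : HasSum (fun i : ℕ => (-1 : ℝ) ^ i * (1 / (k.factorial * i.factorial : ℝ)))
      (1 / (Real.exp 1 * (Nat.factorial (k + 1 - 1) : ℝ))) := by
    have h := (NormedSpace.expSeries_div_hasSum_exp (𝔸 := ℝ) (-1)).mul_left
      (1 / (k.factorial : ℝ))
    rw [← Real.exp_eq_exp_ℝ, Real.exp_neg] at h
    have e1 : (fun i : ℕ => (-1 : ℝ) ^ i * (1 / (k.factorial * i.factorial : ℝ)))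
        = fun i : ℕ => 1 / (k.factorial : ℝ) * ((-1) ^ i / (i.factorial : ℝ)) := by
      funext i
      ring
    have e2 : 1 / (Real.exp 1 * (Nat.factorial (k + 1 - 1) : ℝ))
        = 1 / (k.factorial : ℝ) * (Real.exp 1)⁻¹ := by
      rw [Nat.add_sub_cancel]
      ring
    rw [e1, e2]
    exact h
  have hb : Summable (fun i : ℕ => 1 / (k.factorial * i.factorial : ℝ)) := by
    have h := (Real.summable_pow_div_factorial 1).mul_left (1 / (k.factorial : ℝ))
    refine h.congr ?_
    intro i
    rw [one_pow]
    ring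
  rw [← hs.tsum_eq]
  have hT : Filter.Tendsto (fun m => ∑' i, tm (k + 1) m i) Filter.atTop
      (nhds (∑' i : ℕ, (-1 : ℝ) ^ i * (1 / (k.factorial * i.factorial : ℝ)))) := by
    apply tendsto_tsum_of_dominated_convergence hb (fun i => tm_tendsto k i)
    filter_upwards [MM_tendsto.eventually_ge_atTop 2] with m hm i
    exact tm_bound k m i hm
  refine hT.congr' ?_
  filter_upwards [MM_tendsto.eventually_ge_atTop (k + 2)] with m hm
  exact (pr_eq (k + 1) m (by omega) (by omega)).symm

end
end GLN
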